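/- arXiv:math/0506088 — 2 statements merged into one kernel-verified Lean document; each statement's English description precedes it below -/
import Mathlib

section
/- Let A ∈ I(s,m), B ∈ I(s,q) with 1 ≤ s ≤ n, and let I ∈ I(n,m) be such that A ≱ I (i.e. it is not the case that a_j ≥ i_j for all 1 ≤ j ≤ s). Then in K[X] there exist finitely many triples (A_t, B_t, I_t), with A_t ∈ I(s_t,m), B_t ∈ I(s_t,q) for some 1 ≤ s_t ≤ n and I_t ∈ I(n,m), and scalars d_t ∈ K∖{0}, such that p(A,B)·u(I) = Σ_t d_t · p(A_t,B_t)·u(I_t), where for every t: A_t ≥ A and A_t ≥ I, I_t ≤ A and I_t ≤ I, and B_t ≥ B (with respect to the order on increasing tuples: A ≥ A' iff |A| ≤ |A'| and a_j ≥ a'_j for all j ≤ |A|). -/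
namespace SMB

/-- `geTup f g` : the strictly increasing tuple `f` is `≥` the strictly increasing tuple `g`
in the order on increasing tuples: the length of `f` is at most that of `g`, and `f` is
entrywise `≥` `g` (on the common range of indices). -/
def geTup {N s s' : ℕ} (f : Fin s → Fin N) (g : Fin s' → Fin N) : Prop :=
  ∃ h : s ≤ s', ∀ j : Fin s, g (Fin.castLE h j) ≤ f j

/-- A strictly increasing `s`-tuple with values in `{1,…,N}` (encoded as `Fin N`). -/
structure IncTup (s N : ℕ) where
  f : Fin s → Fin N
  mono : StrictMono f

/-- A pair of strictly increasing tuples of a common length `s`: row indices in `{1,…,m}`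
and column indices in `{1,…,q}`, indexing an `s × s` minor. -/
structure PairIx (m q : ℕ) where
  s : ℕ
  rows : Fin s → Fin m
  cols : Fin s → Fin q
  rmono : StrictMono rows
  cmono : StrictMono cols

/-- The partial order `(A,B) ⪰ (A',B')` on pairs of increasing tuples: `A ≥ A'` and `B ≥ B'`. -/
def PairIx.ge {m q : ℕ} (x y : PairIx m q) : Prop :=
  geTup x.rows y.rows ∧ geTup x.cols y.cols

end SMB
namespace SMB

variable (K : Type) [Field K] (n m q : ℕ)

/-- The coordinate ring `K[X]` of `X = M_{m,n}(K) × M_{n,q}(K)`: the polynomial ring over `K`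
in the entries of a generic `m×n` matrix `U` and a generic `n×q` matrix `W`. -/
abbrev KX := MvPolynomial ((Fin m × Fin n) ⊕ (Fin n × Fin q)) K

/-- The generic `m×n` matrix `U = (u_{ij})`. -/
noncomputable def Ugen : Matrix (Fin m) (Fin n) (KX K n m q) :=
  Matrix.of fun i j => MvPolynomial.X (Sum.inl (i, j))

/-- The generic `n×q` matrix `W = (ξ_{kl})`. -/
noncomputable def Wgen : Matrix (Fin n) (Fin q) (KX K n m q) :=
  Matrix.of fun k l => MvPolynomial.X (Sum.inr (k, l))

/-- `φ_{ij}`, the `(i,j)` entry of the product matrix `UW`. -/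
noncomputable def phi (i : Fin m) (j : Fin q) : KX K n m q :=
  (Ugen K n m q * Wgen K n m q) i j

/-- Evaluation of a polynomial in `K[X]` at a point `(U, W) ∈ X`. -/
noncomputable def evalX (U : Matrix (Fin m) (Fin n) K) (W : Matrix (Fin n) (Fin q) K) :
    KX K n m q →+* K :=
  MvPolynomial.eval (Sum.elim (fun p => U p.1 p.2) (fun p => W p.1 p.2))

variable {K n m q}

/-- `f ∈ K[X]` is invariant under the diagonal action of `GL_n(K)`:
`f(UA, A⁻¹W) = f(U, W)` for all `A ∈ GL_n(K)` and all `(U,W) ∈ X`. -/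
def IsGLInvariant (f : KX K n m q) : Prop :=
  ∀ (A : GL (Fin n) K) (U : Matrix (Fin m) (Fin n) K) (W : Matrix (Fin n) (Fin q) K),
    evalX K n m q (U * (A : Matrix (Fin n) (Fin n) K))
      (((A⁻¹ : GL (Fin n) K) : Matrix (Fin n) (Fin n) K) * W) f = evalX K n m q U W f

/-- `f ∈ K[X]` is invariant under the diagonal action of `SL_n(K)`:
`f(UA, A⁻¹W) = f(U, W)` for all `A ∈ SL_n(K)` and all `(U,W) ∈ X`. -/
def IsSLInvariant (f : KX K n m q) : Prop :=
  ∀ (A : Matrix.SpecialLinearGroup (Fin n) K)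
    (U : Matrix (Fin m) (Fin n) K) (W : Matrix (Fin n) (Fin q) K),
    evalX K n m q (U * (A : Matrix (Fin n) (Fin n) K))
      (((A⁻¹ : Matrix.SpecialLinearGroup (Fin n) K) : Matrix (Fin n) (Fin n) K) * W) f
      = evalX K n m q U W f

variable (K n m q)

end SMB
namespace SMB

variable (K : Type) [Field K] (n m q : ℕ)

/-- `p(A,B)`: the minor of the product matrix `UW` with row indices `A` and column indices `B`. -/
noncomputable def pPoly (x : PairIx m q) : KX K n m q :=
  Matrix.det (Matrix.of fun i j : Fin x.s =>
    (Ugen K n m q * Wgen K n m q) (x.rows i) (x.cols j))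

/-- `u(I)`: the maximal (`n×n`) minor of `U` with row indices `I`. -/
noncomputable def uPoly (I : Fin n → Fin m) : KX K n m q :=
  Matrix.det (Matrix.of fun i j : Fin n => MvPolynomial.X (Sum.inl (I i, j)))

/-- `ξ(J)`: the maximal (`n×n`) minor of `W` with column indices `J`. -/
noncomputable def xiPoly (J : Fin n → Fin q) : KX K n m q :=
  Matrix.det (Matrix.of fun i j : Fin n => MvPolynomial.X (Sum.inr (i, J j)))

end SMB


namespace SMB

/-- Fixing the arguments of an alternating map outside `P`. -/
def restrictAlternating {R M N ι : Type*} [CommRing R] [AddCommGroup M] [Module R M]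
    [AddCommGroup N] [Module R N] [DecidableEq ι] (f : M [⋀^ι]→ₗ[R] N) (P : ι → Prop)
    [DecidablePred P] (w : ι → M) : M [⋀^{i // P i}]→ₗ[R] N where
  toFun v := f fun i => if h : P i then v ⟨i, h⟩ else w i
  map_update_add' := by
    intro inst v i x y
    have key : ∀ z : M, (fun j => if h : P j then Function.update v i z ⟨j, h⟩ else w j) =
        Function.update (fun j => if h : P j then v ⟨j, h⟩ else w j) i.1 z := by
      intro z
      ext j
      by_cases hj : j = i.1
      · subst hj
        simp [i.2]
      · have : ∀ h : P j, (⟨j, h⟩ : {i // P i}) ≠ i := fun h e => hj (congrArg Subtype.val e)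
        simp [Function.update_of_ne hj, Function.update_of_ne (this _)]
    simp only [key, f.map_update_add]
  map_update_smul' := by
    intro inst v i c x
    have key : ∀ z : M, (fun j => if h : P j then Function.update v i z ⟨j, h⟩ else w j) =
        Function.update (fun j => if h : P j then v ⟨j, h⟩ else w j) i.1 z := by
      intro z
      ext j
      by_cases hj : j = i.1
      · subst hj
        simp [i.2]
      · have : ∀ h : P j, (⟨j, h⟩ : {i // P i}) ≠ i := fun h e => hj (congrArg Subtype.val e)
        simp [Function.update_of_ne hj, Function.update_of_ne (this _)]
    simp only [key, f.map_update_smul]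
  map_eq_zero_of_eq' := by
    intro v i j hv hij
    refine f.map_eq_zero_of_eq _ (i := i.1) (j := j.1) ?_ (fun h => hij (Subtype.ext h))
    simp [i.2, j.2, hv]

theorem restrictAlternating_apply {R M N ι : Type*} [CommRing R] [AddCommGroup M] [Module R M]
    [AddCommGroup N] [Module R N] [DecidableEq ι] (f : M [⋀^ι]→ₗ[R] N) (P : ι → Prop)
    [DecidablePred P] (w : ι → M) (v : {i // P i} → M) :
    restrictAlternating f P w v = f fun i => if h : P i then v ⟨i, h⟩ else w i := rfl

/-- A permutation of `X ⊕ Y` that does not preserve `X` increases the total value over `X`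
when all values on `X` are smaller than all values on `Y`. -/
theorem sum_inl_lt_sum_perm_inl {X Y : Type*} [Fintype X] [Fintype Y] [DecidableEq X]
    [DecidableEq Y] (v : X ⊕ Y → ℕ) (b : ℕ) (hX : ∀ x, v (Sum.inl x) ≤ b)
    (hY : ∀ y, b < v (Sum.inr y)) (τ : Equiv.Perm (X ⊕ Y))
    (hτ : ∃ x y, τ (Sum.inl x) = Sum.inr y) :
    ∑ x, v (Sum.inl x) < ∑ x, v (τ (Sum.inl x)) := by
  classical
  obtain ⟨x₀, y₀, h₀⟩ := hτ
  let S : Finset (X ⊕ Y) := Finset.univ.map Function.Embedding.inl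
  let T : Finset (X ⊕ Y) := S.map τ.toEmbedding
  have hS : ∀ z, z ∈ S ↔ ∃ x, Sum.inl x = z := by simp [S]
  have hcard : (S \ T).card = (T \ S).card :=
    Finset.card_sdiff_comm (by simp [T])
  have hsum : ∑ z ∈ S, v z < ∑ z ∈ T, v z := by
    rw [← Finset.sum_inter_add_sum_sdiff S T, ← Finset.sum_inter_add_sum_sdiff T S,
      Finset.inter_comm T S]
    have h1 : ∑ z ∈ S \ T, v z ≤ (S \ T).card * b := by
      simpa using Finset.sum_le_card_nsmul (S \ T) v b (by
        intro z hz
        obtain ⟨x, rfl⟩ := (hS z).1 (Finset.mem_sdiff.1 hz).1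
        exact hX x)
    have h2 : (T \ S).card * (b + 1) ≤ ∑ z ∈ T \ S, v z := by
      simpa using Finset.card_nsmul_le_sum (T \ S) v (b + 1) (by
        intro z hz
        rcases z with x | y
        · exact absurd ((hS _).2 ⟨x, rfl⟩) (Finset.mem_sdiff.1 hz).2
        · exact hY y)
    have h3 : 0 < (T \ S).card := by
      refine Finset.card_pos.2 ⟨Sum.inr y₀, Finset.mem_sdiff.2 ⟨?_, by simp [S]⟩⟩
      exact Finset.mem_map.2 ⟨Sum.inl x₀, by simp [S], h₀⟩
    rw [hcard] at h1
    nlinarith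
  simpa [S, T] using hsum

/-- The straightening step at a violation: if `A k < I k` then the antisymmetrization over
`A 0, …, A k, I k, …, I (n-1)`, which involves more than `n` vectors, vanishes. -/
theorem exchange_mem_span {K R : Type*} [Field K] [CommRing R] [IsDomain R] [Algebra K R]
    {s n m : ℕ} (g : (Fin n → R) [⋀^Fin s]→ₗ[R] R) (h : (Fin n → R) [⋀^Fin n]→ₗ[R] R)
    (U : Fin m → Fin n → R) (A : Fin s → Fin m) (I : Fin n → Fin m)
    (hA : StrictMono A) (hI : StrictMono I) (k : Fin s) (k' : Fin n) (hk : k.1 = k'.1)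
    (hlt : A k < I k') :
    g (U ∘ A) * h (U ∘ I) ∈ Submodule.span K
      {z | ∃ (f : Fin s → Fin m) (e : Fin n → Fin m),
        ∑ j, (A j : ℕ) < ∑ j, (f j : ℕ) ∧ z = g (U ∘ f) * h (U ∘ e)} := by
  classical
  let P : Fin s → Prop := fun j => j ≤ k
  let Q : Fin n → Prop := fun j => k' ≤ j
  let a := restrictAlternating g P (U ∘ A)
  let b := restrictAlternating h Q (U ∘ I)
  let w : {j // P j} ⊕ {j // Q j} → Fin m := Sum.elim (fun j => A j.1) (fun j => I j.1)
  let F : Equiv.Perm ({j // P j} ⊕ {j // Q j}) → Fin s → Fin m := fun τ j =>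
    if h : P j then w (τ (Sum.inl ⟨j, h⟩)) else A j
  let G : Equiv.Perm ({j // P j} ⊕ {j // Q j}) → Fin n → Fin m := fun τ j =>
    if h : Q j then w (τ (Sum.inr ⟨j, h⟩)) else I j
  let L := LinearMap.mul' R R
  have hterm : ∀ τ : Equiv.Perm ({j // P j} ⊕ {j // Q j}),
      L (AlternatingMap.domCoprod.summand a b (Quotient.mk'' τ) (U ∘ w)) =
        Equiv.Perm.sign τ • (g (U ∘ F τ) * h (U ∘ G τ)) := by
    intro τ
    rw [AlternatingMap.domCoprod.summand_mk'']
    have e1 : a (fun i => (U ∘ w) (τ (Sum.inl i))) = g (U ∘ F τ) := by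
      simp only [a, restrictAlternating_apply]
      congr 1
      ext j : 1
      by_cases hj : P j <;> simp [F, hj]
    have e2 : b (fun i => (U ∘ w) (τ (Sum.inr i))) = h (U ∘ G τ) := by
      simp only [b, restrictAlternating_apply]
      congr 1
      ext j : 1
      by_cases hj : Q j <;> simp [G, hj]
    rw [← e1, ← e2]
    simp only [_root_.smul_apply, MultilinearMap.domDomCongr_apply,
      MultilinearMap.domCoprod_apply, L]
    rcases Int.units_eq_one_or (Equiv.Perm.sign τ) with hs | hs <;> simp [hs]
  have hzero : ∑ σ, L (AlternatingMap.domCoprod.summand a b σ (U ∘ w)) = 0 := by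
    have h0 : (a.domCoprod b) (U ∘ w) = 0 := by
      apply AlternatingMap.map_linearDependent
      intro hli
      have h1 := hli.fintype_card_le_finrank
      have hP : Fintype.card {j // P j} = k.1 + 1 := by
        rw [Fintype.card_subtype, ← Fin.card_Iic]
        congr 1
        ext j
        simp [P]
      have hQ : Fintype.card {j // Q j} = n - k'.1 := by
        rw [Fintype.card_subtype, ← Fin.card_Ici]
        congr 1
        ext j
        simp [Q]
      simp only [Fintype.card_sum, hP, hQ, Module.finrank_fin_fun] at h1
      omega
    rw [← map_sum, ← _root_.sum_apply]
    have h2 : (∑ σ, AlternatingMap.domCoprod.summand a b σ) (U ∘ w) = (a.domCoprod b) (U ∘ w) :=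
      rfl
    rw [h2, h0, map_zero]
  have hsplit := Finset.add_sum_erase Finset.univ
    (fun σ => L (AlternatingMap.domCoprod.summand a b σ (U ∘ w)))
    (Finset.mem_univ (Quotient.mk'' 1))
  replace hzero := hsplit.trans hzero
  have hone : L (AlternatingMap.domCoprod.summand a b (Quotient.mk'' 1) (U ∘ w)) =
      g (U ∘ A) * h (U ∘ I) := by
    rw [hterm]
    have e1 : F 1 = A := by
      ext j : 1
      by_cases hj : P j <;> simp [F, w, hj]
    have e2 : G 1 = I := by
      ext j : 1
      by_cases hj : Q j <;> simp [G, w, hj]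
    simp [e1, e2]
  rw [hone] at hzero
  rw [eq_neg_of_add_eq_zero_left hzero]
  refine Submodule.neg_mem _ (Submodule.sum_mem _ ?_)
  intro σ hσ
  obtain ⟨τ, rfl⟩ := Quotient.exists_rep σ
  have hτ : ∃ x y, τ (Sum.inl x) = Sum.inr y := by
    by_contra hcon
    push Not at hcon
    apply (Finset.mem_erase.1 hσ).1
    symm
    refine Quotient.sound' ?_
    rw [QuotientGroup.leftRel_apply]
    simp only [inv_one, one_mul]
    apply Equiv.Perm.mem_sumCongrHom_range_of_perm_mapsTo_inl
    rintro _ ⟨x, rfl⟩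
    rcases hx : τ (Sum.inl x) with y | y
    · exact ⟨y, rfl⟩
    · exact absurd hx (hcon x y)
  have hmem : g (U ∘ F τ) * h (U ∘ G τ) ∈ Submodule.span K
      {z | ∃ (f : Fin s → Fin m) (e : Fin n → Fin m),
        ∑ j, (A j : ℕ) < ∑ j, (f j : ℕ) ∧ z = g (U ∘ f) * h (U ∘ e)} := by
    refine Submodule.subset_span ⟨F τ, G τ, ?_, rfl⟩
    have key := sum_inl_lt_sum_perm_inl (fun z => (w z : ℕ)) (A k : ℕ)
      (fun x => by simpa [w] using hA.monotone x.2)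
      (fun y => by simpa [w] using lt_of_lt_of_le hlt (hI.monotone y.2)) τ hτ
    have hsplit : ∀ u : Fin s → ℕ, ∑ j, u j =
        ∑ x : {j // P j}, u x.1 + ∑ x : {j // ¬ P j}, u x.1 := fun u =>
      (Fintype.sum_subtype_add_sum_subtype P u).symm
    rw [hsplit, hsplit]
    have e1 : ∑ x : {j // P j}, (F τ x.1 : ℕ) =
        ∑ x : {j // P j}, (w (τ (Sum.inl x)) : ℕ) :=
      Finset.sum_congr rfl fun x _ => by simp [F, x.2]
    have e2 : ∑ x : {j // ¬ P j}, (F τ x.1 : ℕ) = ∑ x : {j // ¬ P j}, (A x.1 : ℕ) :=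
      Finset.sum_congr rfl fun x _ => by simp [F, x.2]
    rw [e1, e2]
    exact Nat.add_lt_add_right key _
  have ht := hterm τ
  change L (AlternatingMap.domCoprod.summand a b (Quotient.mk'' τ) (U ∘ w)) ∈ _
  rw [ht]
  rcases Int.units_eq_one_or (Equiv.Perm.sign τ) with hs | hs
  · simpa [hs] using hmem
  · simpa [hs] using hmem

/-- Sorting the arguments of an alternating map. -/
theorem alternating_eq_zero_or_sorted {R M N : Type*} [CommRing R] [AddCommGroup M] [Module R M]
    [AddCommGroup N] [Module R N] {s m : ℕ} (g : M [⋀^Fin s]→ₗ[R] N) (U : Fin m → M)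
    (f : Fin s → Fin m) :
    g (U ∘ f) = 0 ∨ ∃ π : Equiv.Perm (Fin s), StrictMono (f ∘ π) ∧
      (g (U ∘ f) = g (U ∘ (f ∘ π)) ∨ g (U ∘ f) = - g (U ∘ (f ∘ π))) := by
  by_cases hf : Function.Injective f
  · refine Or.inr ⟨Tuple.sort f, (Tuple.monotone_sort f).strictMono_of_injective
      (hf.comp (Tuple.sort f).injective), ?_⟩
    have := g.map_perm (U ∘ f) (Tuple.sort f)
    rw [Function.comp_assoc] at this
    rcases Int.units_eq_one_or (Equiv.Perm.sign (Tuple.sort f)) with hs | hs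
    · left; simp [this, hs]
    · right; simp [this, hs]
  · left
    obtain ⟨i, j, hij, hne⟩ := Function.not_injective_iff.1 hf
    exact g.map_eq_zero_of_eq _ (by simp [hij]) hne

/-- Pairs `(A, I)` of strictly increasing tuples with `A ≥ I`. -/
def stdPairs (s n m : ℕ) (hs : s ≤ n) : Set ((Fin s → Fin m) × (Fin n → Fin m)) :=
  {t | StrictMono t.1 ∧ StrictMono t.2 ∧ ∀ l, t.2 (Fin.castLE hs l) ≤ t.1 l}

/-- Products indexed by standard pairs span all products. -/
theorem mem_span_stdPairs {K R : Type*} [Field K] [CommRing R] [IsDomain R] [Algebra K R]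
    {s n m : ℕ} (hs : s ≤ n) (g : (Fin n → R) [⋀^Fin s]→ₗ[R] R)
    (h : (Fin n → R) [⋀^Fin n]→ₗ[R] R) (U : Fin m → Fin n → R)
    (A : Fin s → Fin m) (I : Fin n → Fin m) :
    g (U ∘ A) * h (U ∘ I) ∈ Submodule.span K
      ((fun t : (Fin s → Fin m) × (Fin n → Fin m) => g (U ∘ t.1) * h (U ∘ t.2)) ''
        stdPairs s n m hs) := by
  induction hN : s * m - ∑ j, (A j : ℕ) using Nat.strong_induction_on generalizing A I with
  | _ N ih =>
  rcases alternating_eq_zero_or_sorted g U A with h0 | ⟨π, hπ, hg⟩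
  · simp [h0]
  rcases alternating_eq_zero_or_sorted h U I with h0 | ⟨ρ, hρ, hh⟩
  · simp [h0]
  have hmain : g (U ∘ (A ∘ π)) * h (U ∘ (I ∘ ρ)) ∈ Submodule.span K
      ((fun t : (Fin s → Fin m) × (Fin n → Fin m) => g (U ∘ t.1) * h (U ∘ t.2)) ''
        stdPairs s n m hs) := by
    by_cases hstd : ∀ l, (I ∘ ρ) (Fin.castLE hs l) ≤ (A ∘ π) l
    · exact Submodule.subset_span ⟨(A ∘ π, I ∘ ρ), ⟨hπ, hρ, hstd⟩, rfl⟩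
    · push Not at hstd
      obtain ⟨k, hk⟩ := hstd
      refine Submodule.span_le.2 ?_
        (exchange_mem_span (K := K) g h U _ _ hπ hρ k (Fin.castLE hs k) rfl hk)
      rintro _ ⟨f, e, hfe, rfl⟩
      refine ih _ ?_ f e rfl
      have h1 : ∑ j, ((A ∘ π) j : ℕ) = ∑ j, (A j : ℕ) := Equiv.sum_comp π fun j => (A j : ℕ)
      have h2 : ∑ j, (f j : ℕ) ≤ s * m := by
        simpa using Finset.sum_le_card_nsmul Finset.univ (fun j => (f j : ℕ)) m
          (fun j _ => (f j).2.le)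
      omega
  rcases hg with hg | hg <;> rcases hh with hh | hh <;> rw [hg, hh] <;> simpa using hmain

/-- The exponent of the monomial `∏ x_{a_j, j} · ∏ x_{e_j, j}`. -/
noncomputable def pairExp {s n m : ℕ} (hs : s ≤ n) (a : Fin s → Fin m) (e : Fin n → Fin m) :
    Fin m × Fin n →₀ ℕ :=
  ∑ j, Finsupp.single (a j, Fin.castLE hs j) 1 + ∑ j, Finsupp.single (e j, j) 1

theorem pairExp_apply_ne_zero_iff {s n m : ℕ} (hs : s ≤ n) (a : Fin s → Fin m)
    (e : Fin n → Fin m) (r : Fin m) (j : Fin n) :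
    pairExp hs a e (r, j) ≠ 0 ↔ (∃ l, a l = r ∧ Fin.castLE hs l = j) ∨ e j = r := by
  classical
  simp only [pairExp, Finsupp.add_apply, Finsupp.finsetSum_apply, Finsupp.single_apply,
    Prod.mk.injEq, ne_eq, Nat.add_eq_zero_iff, Finset.sum_eq_zero_iff, Finset.mem_univ,
    true_imp_iff]
  constructor
  · intro h
    by_contra! hcon
    refine h ⟨fun l => if_neg fun hl => hcon.1 l hl.1 hl.2, fun l => if_neg ?_⟩
    rintro ⟨h1, rfl⟩
    exact hcon.2 h1
  · rintro (⟨l, hl⟩ | hj) ⟨h1, h2⟩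
    · simpa [hl] using h1 l
    · simpa [hj] using h2 j

/-- Coefficients of a product of a minor in the first `s` columns and a maximal minor. -/
theorem coeff_minor_mul_minor {K : Type*} [Field K] {s n m : ℕ} (hs : s ≤ n)
    (A : Fin s → Fin m) (I : Fin n → Fin m) (d : Fin m × Fin n →₀ ℕ) :
    MvPolynomial.coeff d
      (Matrix.det (Matrix.of fun i j : Fin s =>
          (MvPolynomial.X (A i, Fin.castLE hs j) : MvPolynomial (Fin m × Fin n) K)) *
        Matrix.det (Matrix.of fun i j : Fin n => MvPolynomial.X (I i, j))) =
      ∑ σ : Equiv.Perm (Fin s), ∑ τ : Equiv.Perm (Fin n),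
        ((Equiv.Perm.sign σ : ℤ) : K) * ((Equiv.Perm.sign τ : ℤ) : K) *
          if pairExp hs (A ∘ σ) (I ∘ τ) = d then 1 else 0 := by
  classical
  rw [Matrix.det_apply', Matrix.det_apply', Finset.sum_mul_sum, MvPolynomial.coeff_sum]
  refine Finset.sum_congr rfl fun σ _ => ?_
  rw [MvPolynomial.coeff_sum]
  refine Finset.sum_congr rfl fun τ _ => ?_
  have h1 : (∏ i, (Matrix.of fun i j : Fin s =>
          (MvPolynomial.X (A i, Fin.castLE hs j) : MvPolynomial (Fin m × Fin n) K)) (σ i) i) *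
      (∏ i, (Matrix.of fun i j : Fin n =>
          (MvPolynomial.X (I i, j) : MvPolynomial (Fin m × Fin n) K)) (τ i) i) =
      MvPolynomial.monomial (pairExp hs (A ∘ σ) (I ∘ τ)) 1 := by
    simp only [Matrix.of_apply, MvPolynomial.X, ← MvPolynomial.monomial_sum_one,
      MvPolynomial.monomial_mul, mul_one, pairExp, Function.comp_apply]
  rw [mul_mul_mul_comm, h1, ← MvPolynomial.coeff_monomial, ← MvPolynomial.coeff_C_mul]
  simp

theorem le_of_perm_le {s n m : ℕ} (hs : s ≤ n) (ρ : Fin s → Fin n) (hρ : Function.Injective ρ)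
    (x : Fin n → Fin m) (hx : Monotone x) (y : Fin s → Fin m) (hy : Monotone y)
    (h : ∀ l, x (ρ l) ≤ y l) (l : Fin s) : x (Fin.castLE hs l) ≤ y l := by
  obtain ⟨l', hl', hρl⟩ : ∃ l' ≤ l, Fin.castLE hs l ≤ ρ l' := by
    by_contra! hcon
    have h1 := Finset.card_le_card_of_injOn ρ (s := Finset.Iic l)
      (t := Finset.Iio (Fin.castLE hs l))
      (fun a ha => by simpa using hcon a (by simpa using ha)) hρ.injOn
    simp at h1
  exact (hx hρl).trans ((h l').trans (hy hl'))

/-- The diagonal monomial of a standard pair `(A', I')` occurs in the product indexed by `(A, I)`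
only if `A' ≥ A`, `A' ≥ I`, `A ≥ I'` and `I ≥ I'`. -/
theorem order_of_pairExp_eq {s n m : ℕ} (hs : s ≤ n) {A A' : Fin s → Fin m}
    {I I' : Fin n → Fin m} (hA : StrictMono A) (hI : StrictMono I)
    (ht : (A', I') ∈ stdPairs s n m hs) {σ : Equiv.Perm (Fin s)} {τ : Equiv.Perm (Fin n)}
    (h : pairExp hs (A ∘ σ) (I ∘ τ) = pairExp hs A' I') :
    ((∀ l, A (σ l) ≤ A' l) ∧ ∀ j, I' j ≤ I (τ j)) ∧
    (∀ l, A l ≤ A' l) ∧ (∀ l, I (Fin.castLE hs l) ≤ A' l) ∧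
      (∀ l, I' (Fin.castLE hs l) ≤ A l) ∧ ∀ j, I' j ≤ I j := by
  obtain ⟨hA', hI', hstd⟩ := ht
  dsimp only at hA' hI' hstd
  have hmem : ∀ r j, ((∃ l, (A ∘ σ) l = r ∧ Fin.castLE hs l = j) ∨ (I ∘ τ) j = r) →
      (∃ l, A' l = r ∧ Fin.castLE hs l = j) ∨ I' j = r := by
    intro r j hr
    rwa [← pairExp_apply_ne_zero_iff, ← h, pairExp_apply_ne_zero_iff]
  have h1 : ∀ l, I' (Fin.castLE hs l) ≤ A (σ l) ∧ A (σ l) ≤ A' l := by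
    intro l
    rcases hmem (A (σ l)) (Fin.castLE hs l) (Or.inl ⟨l, rfl, rfl⟩) with ⟨l', e, hl⟩ | e
    · rw [Fin.castLE_inj] at hl
      subst hl
      exact e ▸ ⟨hstd l', le_rfl⟩
    · exact e ▸ ⟨le_rfl, hstd l⟩
  have h2 : ∀ j, I' j ≤ I (τ j) := by
    intro j
    rcases hmem (I (τ j)) j (Or.inr rfl) with ⟨l', e, rfl⟩ | e
    · exact e ▸ hstd l'
    · exact e.le
  have h3 : ∀ l, I (τ (Fin.castLE hs l)) ≤ A' l := by
    intro l
    rcases hmem (I (τ (Fin.castLE hs l))) (Fin.castLE hs l) (Or.inr rfl) with ⟨l', e, hl⟩ | e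
    · rw [Fin.castLE_inj] at hl
      subst hl
      exact e.ge
    · exact e ▸ hstd l
  refine ⟨⟨fun l => (h1 l).2, h2⟩, ?_, ?_, ?_, ?_⟩
  · exact le_of_perm_le le_rfl σ σ.injective A hA.monotone A' hA'.monotone fun l => (h1 l).2
  · exact le_of_perm_le hs (fun l => τ (Fin.castLE hs l))
      (τ.injective.comp (Fin.castLE_injective hs)) I hI.monotone A' hA'.monotone h3
  · refine le_of_perm_le le_rfl σ.symm σ.symm.injective (I' ∘ Fin.castLE hs)
      (hI'.monotone.comp (Fin.strictMono_castLE hs).monotone) A hA.monotone fun l => ?_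
    simpa using (h1 (σ.symm l)).1
  · refine le_of_perm_le le_rfl τ.symm τ.symm.injective I' hI'.monotone I hI.monotone fun l => ?_
    simpa using h2 (τ.symm l)

/-- The substitution `W ↦ W₀`, where `W₀` has the identity in the first rows and the
columns `B`. -/
noncomputable def specializeW (K : Type) [Field K] {n m q s : ℕ} (hs : s ≤ n)
    (B : Fin s → Fin q) : KX K n m q →ₐ[K] MvPolynomial (Fin m × Fin n) K :=
  open Classical in
  MvPolynomial.aeval (Sum.elim (fun p => MvPolynomial.X p)
    (fun p => if ∃ l, Fin.castLE hs l = p.1 ∧ B l = p.2 then 1 else 0))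

theorem specializeW_uPoly (K : Type) [Field K] {n m q s : ℕ} (hs : s ≤ n) (B : Fin s → Fin q)
    (I : Fin n → Fin m) : specializeW K hs B (uPoly K n m q I) =
      Matrix.det (Matrix.of fun i j : Fin n => MvPolynomial.X (I i, j)) := by
  rw [uPoly, AlgHom.map_det]
  congr 1
  ext1 i j
  simp [specializeW]

theorem specializeW_pPoly (K : Type) [Field K] {n m q s : ℕ} (hs : s ≤ n) (A : Fin s → Fin m)
    (hA : StrictMono A) (B : Fin s → Fin q) (hB : StrictMono B) :
    specializeW K hs B (pPoly K n m q ⟨s, A, B, hA, hB⟩) =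
      Matrix.det (Matrix.of fun i j : Fin s => MvPolynomial.X (A i, Fin.castLE hs j)) := by
  classical
  rw [pPoly, AlgHom.map_det]
  congr 1
  ext1 i j
  have h : ∀ k : Fin n, (∃ l, Fin.castLE hs l = k ∧ B l = B j) ↔ k = Fin.castLE hs j := by
    intro k
    constructor
    · rintro ⟨l, rfl, hl⟩
      rw [hB.injective hl]
    · rintro rfl
      exact ⟨j, rfl, rfl⟩
  simp [specializeW, Matrix.mul_apply, Ugen, Wgen, h]

/-- In an expansion of a product into standard products, only pairs `(A', I')` with `A' ≥ A`,
`A' ≥ I`, `A ≥ I'` and `I ≥ I'` occur. -/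
theorem order_of_mem_support {K : Type*} [Field K] {s n m : ℕ} (hs : s ≤ n)
    (A : Fin s → Fin m) (I : Fin n → Fin m) (hA : StrictMono A) (hI : StrictMono I)
    (N : (Fin s → Fin m) × (Fin n → Fin m) → MvPolynomial (Fin m × Fin n) K)
    (hN : ∀ t, N t = Matrix.det (Matrix.of fun i j : Fin s =>
          (MvPolynomial.X (t.1 i, Fin.castLE hs j) : MvPolynomial (Fin m × Fin n) K)) *
        Matrix.det (Matrix.of fun i j : Fin n => MvPolynomial.X (t.2 i, j)))
    (c : (Fin s → Fin m) × (Fin n → Fin m) →₀ K)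
    (hstd : ∀ t ∈ c.support, t ∈ stdPairs s n m hs)
    (heq : N (A, I) = ∑ t ∈ c.support, c t • N t) :
    ∀ t ∈ c.support, (∀ l, A l ≤ t.1 l) ∧ (∀ l, I (Fin.castLE hs l) ≤ t.1 l) ∧
      (∀ l, t.2 (Fin.castLE hs l) ≤ A l) ∧ ∀ j, t.2 j ≤ I j := by
  classical
  let good : (Fin s → Fin m) × (Fin n → Fin m) → Prop := fun t =>
    (∀ l, A l ≤ t.1 l) ∧ (∀ l, I (Fin.castLE hs l) ≤ t.1 l) ∧
      (∀ l, t.2 (Fin.castLE hs l) ≤ A l) ∧ ∀ j, t.2 j ≤ I j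
  by_contra hcon
  have hne : (c.support.filter fun t => ¬ good t).Nonempty := by
    push Not at hcon
    obtain ⟨t, ht, hbad⟩ := hcon
    refine ⟨t, Finset.mem_filter.2 ⟨ht, fun hg => ?_⟩⟩
    obtain ⟨j, hj⟩ := hbad hg.1 hg.2.1 hg.2.2.1
    exact absurd (hg.2.2.2 j) (not_le.2 hj)
  let μ : (Fin s → Fin m) × (Fin n → Fin m) → ℤ := fun t =>
    ∑ l, ((t.1 l : ℕ) : ℤ) - ∑ j, ((t.2 j : ℕ) : ℤ)
  obtain ⟨t, ht, hmin⟩ := Finset.exists_min_image _ μ hne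
  obtain ⟨htc, htbad⟩ := Finset.mem_filter.1 ht
  have hts := hstd t htc
  have hcoeff : ∀ t', (∀ (σ : Equiv.Perm (Fin s)) (τ : Equiv.Perm (Fin n)),
      pairExp hs (t'.1 ∘ σ) (t'.2 ∘ τ) ≠ pairExp hs t.1 t.2) →
      MvPolynomial.coeff (pairExp hs t.1 t.2) (N t') = 0 := by
    intro t' h
    rw [hN, coeff_minor_mul_minor]
    refine Finset.sum_eq_zero fun σ _ => Finset.sum_eq_zero fun τ _ => ?_
    rw [if_neg (h σ τ), mul_zero]
  have h1 : MvPolynomial.coeff (pairExp hs t.1 t.2) (N (A, I)) = 0 :=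
    hcoeff _ fun σ τ h => htbad (order_of_pairExp_eq hs hA hI hts h).2
  have h2 : ∀ t' ∈ c.support, t' ≠ t → MvPolynomial.coeff (pairExp hs t.1 t.2) (N t') = 0 := by
    intro t' ht' hne'
    refine hcoeff _ fun σ τ h => ?_
    obtain ⟨hA', hI', -⟩ := hstd t' ht'
    obtain ⟨-, o1, -, -, o4⟩ := order_of_pairExp_eq hs hA' hI' hts h
    by_cases hg : good t'
    · refine htbad ?_
      obtain ⟨g1, g2, g3, g4⟩ := hg
      exact ⟨fun l => (g1 l).trans (o1 l), fun l => (g2 l).trans (o1 l),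
        fun l => (o4 _).trans (g3 l), fun j => (o4 j).trans (g4 j)⟩
    · have hle := hmin t' (Finset.mem_filter.2 ⟨ht', hg⟩)
      have s1 : ∑ l, ((t'.1 l : ℕ) : ℤ) ≤ ∑ l, ((t.1 l : ℕ) : ℤ) :=
        Finset.sum_le_sum fun l _ => by exact_mod_cast o1 l
      have s2 : ∑ l, ((t.2 l : ℕ) : ℤ) ≤ ∑ l, ((t'.2 l : ℕ) : ℤ) :=
        Finset.sum_le_sum fun l _ => by exact_mod_cast o4 l
      have e1 : ∑ l, ((t'.1 l : ℕ) : ℤ) = ∑ l, ((t.1 l : ℕ) : ℤ) := by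
        simp only [μ] at hle
        linarith
      have e2 : ∑ l, ((t.2 l : ℕ) : ℤ) = ∑ l, ((t'.2 l : ℕ) : ℤ) := by
        simp only [μ] at hle
        linarith
      have f1 := (Finset.sum_eq_sum_iff_of_le fun l _ => by exact_mod_cast o1 l).1 e1
      have f2 := (Finset.sum_eq_sum_iff_of_le fun l _ => by exact_mod_cast o4 l).1 e2
      refine hne' (Prod.ext (funext fun l => ?_) (funext fun l => ?_))
      · exact Fin.ext (by exact_mod_cast f1 l (Finset.mem_univ l))
      · exact Fin.ext (by exact_mod_cast (f2 l (Finset.mem_univ l)).symm)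
  have h3 : MvPolynomial.coeff (pairExp hs t.1 t.2) (N t) = 1 := by
    have hone : ∀ (σ : Equiv.Perm (Fin s)) (τ : Equiv.Perm (Fin n)),
        pairExp hs (t.1 ∘ σ) (t.2 ∘ τ) = pairExp hs t.1 t.2 → σ = 1 ∧ τ = 1 := by
      intro σ τ h
      obtain ⟨⟨o1, o2⟩, -⟩ := order_of_pairExp_eq hs hts.1 hts.2.1 hts h
      have p1 : ∀ l, σ l ≤ l := fun l => hts.1.le_iff_le.1 (o1 l)
      have p2 : ∀ j, j ≤ τ j := fun j => hts.2.1.le_iff_le.1 (o2 j)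
      have q1 := (Finset.sum_eq_sum_iff_of_le (s := Finset.univ)
        (f := fun l => (σ l : ℕ)) (g := fun l => (l : ℕ)) fun l _ => p1 l).1
        (Equiv.sum_comp σ fun l => (l : ℕ))
      have q2 := (Finset.sum_eq_sum_iff_of_le (s := Finset.univ)
        (f := fun l : Fin n => (l : ℕ)) (g := fun l => (τ l : ℕ)) fun l _ => p2 l).1
        (Equiv.sum_comp τ fun l => (l : ℕ)).symm
      exact ⟨Equiv.ext fun l => Fin.ext (q1 l (Finset.mem_univ l)),
        Equiv.ext fun l => Fin.ext (q2 l (Finset.mem_univ l)).symm⟩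
    rw [hN, coeff_minor_mul_minor, Finset.sum_eq_single 1, Finset.sum_eq_single 1]
    · simp
    · intro τ _ hτ
      rw [if_neg fun h => hτ (hone _ _ h).2, mul_zero]
    · simp
    · intro σ _ hσ
      refine Finset.sum_eq_zero fun τ _ => ?_
      rw [if_neg fun h => hσ (hone _ _ h).1, mul_zero]
    · simp
  rw [heq, MvPolynomial.coeff_sum, Finset.sum_eq_single t] at h1
  · rw [MvPolynomial.coeff_smul, h3, smul_eq_mul, mul_one] at h1
    exact Finsupp.mem_support_iff.1 htc h1
  · intro t' ht' hne'
    rw [MvPolynomial.coeff_smul, h2 t' ht' hne', smul_zero]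
  · exact fun h => absurd htc h

end SMB

open SMB in
/-- **Straightening relation for `p(A,B)·u(I)`.**
If `(A,B)` indexes a minor of `UW` with `1 ≤ |A| = |B| ≤ n`, `I ∈ I(n,m)`, and `A ≱ I`,
then `p(A,B)u(I) = Σₜ dₜ p(Aₜ,Bₜ)u(Iₜ)` (a finite sum, nonzero coefficients), where for
every `t`: `Aₜ ≥ A`, `Aₜ ≥ I`, `Iₜ ≤ A`, `Iₜ ≤ I` and `Bₜ ≥ B` (in the order on
increasing tuples). -/
theorem p_times_u_straightening (K : Type) [Field K] [IsAlgClosed K]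
    (n m q : ℕ) (hn : 0 < n) (hm : n < m) (hq : n < q)
    (x : PairIx m q) (hxs : 0 < x.s) (hxn : x.s ≤ n)
    (I : IncTup n m) (hAI : ¬ geTup x.rows I.f) :
    ∃ (T : Finset (PairIx m q × IncTup n m)) (c : PairIx m q × IncTup n m → K),
      (pPoly K n m q x * uPoly K n m q I.f =
        ∑ t ∈ T, c t • (pPoly K n m q t.1 * uPoly K n m q t.2.f)) ∧
      ∀ t ∈ T, c t ≠ 0 ∧ 0 < t.1.s ∧ t.1.s ≤ n ∧
        geTup t.1.rows x.rows ∧ geTup t.1.rows I.f ∧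
        geTup x.rows t.2.f ∧ geTup I.f t.2.f ∧
        geTup t.1.cols x.cols := by
  classical
  obtain ⟨s, A, B, hA, hB⟩ := x
  dsimp only at hxs hxn hAI
  let g : (Fin n → KX K n m q) [⋀^Fin s]→ₗ[KX K n m q] KX K n m q :=
    Matrix.detRowAlternating.compLinearMap
      (Matrix.vecMulLinear ((Wgen K n m q).submatrix id B))
  let h : (Fin n → KX K n m q) [⋀^Fin n]→ₗ[KX K n m q] KX K n m q := Matrix.detRowAlternating
  have hg : ∀ (A' : Fin s → Fin m) (hA' : StrictMono A'),
      g (Ugen K n m q ∘ A') = pPoly K n m q ⟨s, A', B, hA', hB⟩ := fun _ _ => rfl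
  have hh : ∀ I' : Fin n → Fin m, h (Ugen K n m q ∘ I') = uPoly K n m q I' := fun _ => rfl
  obtain ⟨c, hc, hsum⟩ := (Finsupp.mem_span_image_iff_linearCombination K).1
    (mem_span_stdPairs (K := K) hxn g h (Ugen K n m q) A I.f)
  rw [Finsupp.linearCombination_apply, Finsupp.sum] at hsum
  have hstd : ∀ t ∈ c.support, t ∈ stdPairs s n m hxn := fun t ht => hc ht
  have horder := order_of_mem_support (K := K) hxn A I.f hA I.mono _ (fun t => rfl) c hstd (by
    have := congrArg (specializeW K hxn B) hsum
    rw [map_sum, map_mul, hg _ hA, hh, specializeW_pPoly, specializeW_uPoly] at this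
    rw [← this]
    refine Finset.sum_congr rfl fun t ht => ?_
    rw [map_smul, map_mul, hg _ (hstd t ht).1, hh, specializeW_pPoly, specializeW_uPoly])
  let φ : {t // t ∈ c.support} → PairIx m q × IncTup n m := fun t =>
    (⟨s, t.1.1, B, (hstd _ t.2).1, hB⟩, ⟨t.1.2, (hstd _ t.2).2.1⟩)
  have hφ : Function.Injective φ := by
    rintro ⟨⟨a, e⟩, h1⟩ ⟨⟨a', e'⟩, h2⟩ heq
    simpa [φ] using heq
  refine ⟨Finset.univ.image φ, Function.extend φ (fun t => c t.1) 0, ?_, ?_⟩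
  · rw [Finset.sum_image hφ.injOn]
    simp only [hφ.extend_apply]
    rw [← hg, ← hh, ← hsum, ← Finset.sum_coe_sort]
    exact Finset.sum_congr rfl fun t _ => by rw [hg _ (hstd _ t.2).1, hh]
  · intro t ht
    obtain ⟨t, -, rfl⟩ := Finset.mem_image.1 ht
    rw [hφ.extend_apply]
    obtain ⟨o1, o2, o3, o4⟩ := horder t.1 t.2
    exact ⟨Finsupp.mem_support_iff.1 t.2, hxs, hxn, ⟨le_rfl, o1⟩, ⟨hxn, o2⟩, ⟨hxn, o3⟩,
      ⟨le_rfl, o4⟩, ⟨le_rfl, fun _ => le_rfl⟩⟩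
end

section
/- The partially ordered set H is ranked of rank (m+q)n − n², i.e. every maximal chain in H has cardinality (m+q)n − n² + 1. -/
namespace SMB

variable (n m q : ℕ)

/-- The index set `H = H_u ⊔ H_ξ ⊔ H_p`, where `H_u = I(n,m)`, `H_ξ = I(n,q)` and
`H_p = ⋃_{1 ≤ r ≤ n} I(r,m) × I(r,q)`. -/
abbrev HElt := IncTup n m ⊕ (IncTup n q ⊕ {x : PairIx m q // 0 < x.s ∧ x.s ≤ n})

variable {n m q}

/-- The partial order on `H`: componentwise order on `H_u` and on `H_ξ`; the order `⪰` on
`H_p`; elements of `H_u` and `H_ξ` mutually incomparable; no element of `H_u ∪ H_ξ` above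
any element of `H_p`; `I ≤ (A,B)` iff `I ≤ A`, and `J ≤ (A,B)` iff `J ≤ B`. -/
def hle : HElt n m q → HElt n m q → Prop
  | Sum.inl I, Sum.inl I' => ∀ j, I.f j ≤ I'.f j
  | Sum.inl I, Sum.inr (Sum.inr P) => geTup P.val.rows I.f
  | Sum.inr (Sum.inl J), Sum.inr (Sum.inl J') => ∀ j, J.f j ≤ J'.f j
  | Sum.inr (Sum.inl J), Sum.inr (Sum.inr P) => geTup P.val.cols J.f
  | Sum.inr (Sum.inr P), Sum.inr (Sum.inr P') => PairIx.ge P'.val P.val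
  | _, _ => False

end SMB

/-- If `r` is a preorder relation with a greatest element `t`, graded by `rk` so that strict
relations raise `rk`, intervals can be climbed one rank at a time, and every element dominates one
of rank `k₀`, then every maximal finite chain has one element in each rank from `k₀` to `rk t`. -/
theorem card_maximal_chain_of_rank {α : Type*} (r : α → α → Prop) (refl : ∀ x, r x x)
    (trans : ∀ x y z, r x y → r y z → r x z) (rk : α → ℕ)
    (strict : ∀ x y, r x y → x ≠ y → rk x < rk y)
    (step : ∀ x y, r x y → x ≠ y → ∃ z, r x z ∧ r z y ∧ rk z = rk x + 1)
    (k₀ : ℕ) (bot : ∀ y, ∃ z, r z y ∧ rk z = k₀) (t : α) (top : ∀ x, r x t)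
    (C : Finset α) (hC : IsChain r (C : Set α))
    (hmax : ∀ C' : Finset α, IsChain r (C' : Set α) → C ⊆ C' → C' = C) :
    C.card = rk t - k₀ + 1 := by
  classical
  have mono : ∀ x y, r x y → rk x ≤ rk y := fun x y h => by
    by_cases e : x = y
    · rw [e]
    · exact (strict x y h e).le
  have mem_of_comparable : ∀ z, (∀ w ∈ C, r z w ∨ r w z) → z ∈ C := by
    intro z hz
    have h : insert z C = C := by
      refine hmax _ ?_ (Finset.subset_insert _ _)
      rw [Finset.coe_insert]
      exact hC.insert fun w hw _ => hz w hw
    rw [← h]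
    exact Finset.mem_insert_self _ _
  have le_of_rk : ∀ x ∈ C, ∀ y ∈ C, rk x ≤ rk y → r x y := by
    intro x hx y hy h
    by_cases e : x = y
    · exact e ▸ refl x
    · rcases hC hx hy e with h' | h'
      · exact h'
      · exact absurd (strict y x h' (Ne.symm e)) (not_lt.mpr h)
  have top_mem : t ∈ C := mem_of_comparable t fun w _ => Or.inr (top w)
  have le_rk : ∀ x, k₀ ≤ rk x := fun x => by
    obtain ⟨z, hz, e⟩ := bot x
    exact e ▸ mono z x hz
  have hit : ∀ d, k₀ + d ≤ rk t → ∃ x ∈ C, rk x = k₀ + d := by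
    intro d
    induction d with
    | zero =>
      intro _
      obtain ⟨y, hy, hmin⟩ := C.exists_min_image rk ⟨t, top_mem⟩
      obtain ⟨z, hz, e⟩ := bot y
      exact ⟨z, mem_of_comparable z fun w hw =>
        Or.inl (trans _ _ _ hz (le_of_rk y hy w hw (hmin w hw))), e⟩
    | succ d ih =>
      intro hd
      obtain ⟨x, hx, ex⟩ := ih (by omega)
      obtain ⟨y, hy, hmin⟩ := (C.filter fun y => rk x < rk y).exists_min_image rk
        ⟨t, Finset.mem_filter.mpr ⟨top_mem, by omega⟩⟩
      rw [Finset.mem_filter] at hy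
      obtain ⟨z, hxz, hzy, ez⟩ := step x y (le_of_rk x hx y hy.1 hy.2.le)
        (fun e => by rw [e] at hy; exact lt_irrefl _ hy.2)
      refine ⟨z, mem_of_comparable z fun w hw => ?_, by omega⟩
      rcases le_or_gt (rk w) (rk x) with h | h
      · exact Or.inr (trans _ _ _ (le_of_rk w hw x hx h) hxz)
      · exact Or.inl (trans _ _ _ hzy
          (le_of_rk y hy.1 w hw (hmin w (Finset.mem_filter.mpr ⟨hw, h⟩))))
  have inj : Set.InjOn rk (C : Set α) := by
    intro x hx y hy e
    by_contra hne
    exact absurd e (strict x y (le_of_rk x hx y hy e.le) hne).ne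
  have himage : C.image rk = Finset.Icc k₀ (rk t) := by
    ext k
    rw [Finset.mem_image, Finset.mem_Icc]
    constructor
    · rintro ⟨x, _, rfl⟩
      exact ⟨le_rk x, mono x t (top x)⟩
    · rintro ⟨h₁, h₂⟩
      obtain ⟨x, hx, e⟩ := hit (k - k₀) (by omega)
      exact ⟨x, hx, by omega⟩
  have hle := le_rk t
  rw [← Finset.card_image_of_injOn inj, himage, Nat.card_Icc]
  omega

namespace SMB

section Tuples

variable {N s s' s'' : ℕ}

theorem geTup_refl (f : Fin s → Fin N) : geTup f f := ⟨le_rfl, fun _ => le_rfl⟩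

theorem geTup_trans {f : Fin s → Fin N} {g : Fin s' → Fin N} {h : Fin s'' → Fin N}
    (hfg : geTup f g) (hgh : geTup g h) : geTup f h :=
  ⟨hfg.1.trans hgh.1, fun j => (hgh.2 (Fin.castLE hfg.1 j)).trans (hfg.2 j)⟩

theorem strictMono_index_le {f : Fin s → Fin N} (hf : StrictMono f) (j : Fin s) :
    (j : ℕ) ≤ f j := by
  obtain ⟨j, hj⟩ := j
  induction j with
  | zero => exact Nat.zero_le _
  | succ j ih =>
    have h₁ := ih (by omega)
    have h₂ : f ⟨j, by omega⟩ < f ⟨j + 1, hj⟩ := hf (Fin.mk_lt_mk.mpr (Nat.lt_succ_self j))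
    rw [Fin.lt_def] at h₂
    dsimp only at *
    omega

theorem strictMono_add_le {f : Fin s → Fin N} (hf : StrictMono f) (j : Fin s) :
    (f j : ℕ) + (s - j) ≤ N := by
  obtain ⟨j, hj⟩ := j
  obtain ⟨d, hd⟩ : ∃ d, s = j + 1 + d := ⟨s - (j + 1), by omega⟩
  induction d generalizing j with
  | zero =>
    have := (f ⟨j, hj⟩).isLt
    dsimp only
    omega
  | succ d ih =>
    have h₁ := ih (j + 1) (by omega) (by omega)
    have h₂ : f ⟨j, hj⟩ < f ⟨j + 1, by omega⟩ := hf (Fin.mk_lt_mk.mpr (Nat.lt_succ_self j))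
    rw [Fin.lt_def] at h₂
    dsimp only at *
    omega

theorem geTup_castLE {f : Fin s → Fin N} (hf : StrictMono f) (hs : s ≤ s') (h : s' ≤ N) :
    geTup f (Fin.castLE h) :=
  ⟨hs, fun j => Fin.le_def.mpr (strictMono_index_le hf j)⟩

theorem geTup_sum_le {d : ℕ} {g : Fin s → Fin N} {f : Fin (s + d) → Fin N} (h : geTup g f) :
    ∑ j, (f j : ℕ) + d ≤ ∑ j, (g j : ℕ) + d * N := by
  rw [Fin.sum_univ_add]
  have h₁ : ∑ j : Fin s, (f (Fin.castAdd d j) : ℕ) ≤ ∑ j, (g j : ℕ) :=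
    Finset.sum_le_sum fun j _ => h.2 j
  have h₂ : ∑ j : Fin d, ((f (Fin.natAdd s j) : ℕ) + 1) ≤ ∑ _j : Fin d, N :=
    Finset.sum_le_sum fun j _ => (f (Fin.natAdd s j)).isLt
  rw [Finset.sum_add_distrib] at h₂
  simp only [Finset.sum_const, Finset.card_univ, Fintype.card_fin, smul_eq_mul, mul_one] at h₂
  omega

theorem eq_of_geTup_of_sum_le {g f : Fin s → Fin N} (h : geTup g f)
    (hsum : ∑ j, (g j : ℕ) ≤ ∑ j, (f j : ℕ)) : f = g := by
  have h₁ : ∀ j ∈ Finset.univ, (f j : ℕ) ≤ g j := fun j _ => h.2 j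
  have h₂ := (Finset.sum_eq_sum_iff_of_le h₁).mp (le_antisymm (Finset.sum_le_sum h₁) hsum)
  exact funext fun j => Fin.ext (h₂ j (Finset.mem_univ j))

/-- Below `g`, a tuple `f` can be raised by one in a single entry, unless each of its entries
either agrees with that of `g` or is as large as its position permits. -/
theorem exists_raise_or_forall {f : Fin s → Fin N} (hf : StrictMono f) {g : Fin s' → Fin N}
    (hg : StrictMono g) (h : geTup g f) :
    (∃ f' : Fin s → Fin N, StrictMono f' ∧ geTup f' f ∧ geTup g f' ∧
      ∑ j, (f' j : ℕ) = ∑ j, (f j : ℕ) + 1) ∨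
    ∀ j : Fin s, (f j : ℕ) + (s - j) = N ∨ ∃ hj : (j : ℕ) < s', f j = g ⟨j, hj⟩ := by
  classical
  rw [or_iff_not_imp_right]
  intro hne
  push Not at hne
  obtain ⟨j₀, hj₀⟩ := hne
  obtain ⟨j, hj, hjmax⟩ := (Finset.univ.filter fun j : Fin s =>
    (f j : ℕ) + (s - j) ≠ N ∧ ∀ hj : (j : ℕ) < s', f j ≠ g ⟨j, hj⟩).exists_max_image id
      ⟨j₀, Finset.mem_filter.mpr ⟨Finset.mem_univ _, hj₀⟩⟩
  simp only [Finset.mem_filter, Finset.mem_univ, true_and, id] at hj hjmax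
  obtain ⟨hjN, hjg⟩ := hj
  have hb := strictMono_add_le hf j
  have hjs := j.isLt
  have hN : (f j : ℕ) + 1 < N := by omega
  have hfg : ∀ hj : (j : ℕ) < s', (f j : ℕ) < g ⟨j, hj⟩ := fun hj => by
    have h₁ := h.2 ⟨j, hj⟩
    have h₂ := hjg hj
    rw [Fin.le_def] at h₁
    rw [Ne, Fin.ext_iff] at h₂
    exact lt_of_le_of_ne h₁ h₂
  have hnext : ∀ k : Fin s, j < k → (f j : ℕ) + 1 < f k := by
    intro k hk
    have hk' : (j : ℕ) < k := hk
    have hks := k.isLt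
    have hjk : (f j : ℕ) < f k := hf hk
    rcases Nat.lt_or_ge ((j : ℕ) + 1) k with hk₁ | hk₁
    · have h₁ : (f j : ℕ) < f ⟨j + 1, by omega⟩ := hf (Fin.lt_def.mpr (Nat.lt_succ_self _))
      have h₂ : (f ⟨j + 1, by omega⟩ : ℕ) < f k := hf (Fin.lt_def.mpr hk₁)
      omega
    · by_contra hcon
      refine absurd (hjmax k ⟨by omega, fun hks' e => ?_⟩) (not_le.mpr hk)
      have h₁ := hfg (by omega)
      have h₂ : (g ⟨j, by omega⟩ : ℕ) < g ⟨k, hks'⟩ := hg (Fin.lt_def.mpr hk')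
      rw [Fin.ext_iff] at e
      omega
  refine ⟨Function.update f j ⟨f j + 1, hN⟩, ?_, ⟨le_rfl, fun k => ?_⟩, ⟨h.1, fun k => ?_⟩, ?_⟩
  · intro k l hkl
    have hkl' : f k < f l := hf hkl
    rw [Fin.lt_def] at hkl' ⊢
    by_cases ek : k = j
    · subst ek
      have hl : l ≠ k := hkl.ne'
      simpa [Function.update_of_ne hl] using hnext l hkl
    · by_cases el : l = j
      · subst el
        simp only [Function.update_of_ne ek, Function.update_self]
        omega
      · simpa [Function.update_of_ne ek, Function.update_of_ne el] using hkl'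
  · change f k ≤ _
    by_cases ek : k = j
    · subst ek
      rw [Function.update_self, Fin.le_def]
      exact Nat.le_succ _
    · rw [Function.update_of_ne ek]
  · by_cases ek : Fin.castLE h.1 k = j
    · subst ek
      rw [Function.update_self, Fin.le_def]
      exact hfg k.isLt
    · rw [Function.update_of_ne ek]
      exact h.2 k
  · rw [← Finset.add_sum_erase _ _ (Finset.mem_univ j),
      ← Finset.add_sum_erase _ (fun k => (f k : ℕ)) (Finset.mem_univ j), Function.update_self,
      Finset.sum_congr rfl fun k hk => by rw [Function.update_of_ne (Finset.ne_of_mem_erase hk)]]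
    dsimp only
    omega

theorem geTup_castSucc_self (f : Fin (s + 1) → Fin N) : geTup (fun j : Fin s => f j.castSucc) f :=
  ⟨Nat.le_succ s, fun _ => le_rfl⟩

theorem geTup_castSucc_of_le {f : Fin (s + 1) → Fin N} {g : Fin s' → Fin N} (h : geTup g f)
    (hs : s' ≤ s) : geTup g (fun j : Fin s => f j.castSucc) :=
  ⟨hs, h.2⟩

/-- If every entry of `f` either agrees with that of `g` or is as large as its position permits,
then `f = g` when the lengths agree. -/
theorem eq_of_forall_eq_or_maximal {f g : Fin s → Fin N} (hg : StrictMono g) (h : geTup g f)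
    (hfg : ∀ j : Fin s, (f j : ℕ) + (s - j) = N ∨ ∃ hj : (j : ℕ) < s, f j = g ⟨j, hj⟩) :
    f = g := by
  funext j
  rcases hfg j with hj | ⟨_, hj⟩
  · have h₁ := strictMono_add_le hg j
    have h₂ : (f j : ℕ) ≤ g j := h.2 j
    exact Fin.ext (by omega)
  · exact hj

end Tuples

variable {n m q : ℕ}

theorem PairIx.ge_refl (x : PairIx m q) : x.ge x := ⟨geTup_refl _, geTup_refl _⟩

theorem PairIx.ge_trans {x y z : PairIx m q} (hxy : x.ge y) (hyz : y.ge z) : x.ge z :=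
  ⟨geTup_trans hxy.1 hyz.1, geTup_trans hxy.2 hyz.2⟩

/-- The rank of a pair of tuples of length at most `n`: missing entries count as if they were one
past the end of their range, and each entry present contributes one more. -/
def PairIx.rank (n : ℕ) (x : PairIx m q) : ℕ :=
  ∑ j, (x.rows j : ℕ) + ∑ j, (x.cols j : ℕ) + x.s + (n - x.s) * (m + q)

theorem PairIx.rank_mk {s : ℕ} (n : ℕ) (a : Fin s → Fin m) (b : Fin s → Fin q)
    (ha : StrictMono a) (hb : StrictMono b) :
    PairIx.rank n ⟨s, a, b, ha, hb⟩ =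
      ∑ j, (a j : ℕ) + ∑ j, (b j : ℕ) + s + (n - s) * (m + q) := rfl

theorem PairIx.rank_lt {x y : PairIx m q} (hx : x.s ≤ n) (h : y.ge x) (hne : x ≠ y) :
    x.rank n < y.rank n := by
  obtain ⟨s, a, b, ha, hb⟩ := x
  obtain ⟨s', a', b', ha', hb'⟩ := y
  obtain ⟨h₁, h₂⟩ := h
  dsimp only at *
  rw [rank_mk, rank_mk]
  rcases h₁.1.eq_or_lt with rfl | hlt
  · by_contra hcon
    have e₁ : ∑ j, (a j : ℕ) ≤ ∑ j, (a' j : ℕ) := Finset.sum_le_sum fun j _ => h₁.2 j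
    have e₂ : ∑ j, (b j : ℕ) ≤ ∑ j, (b' j : ℕ) := Finset.sum_le_sum fun j _ => h₂.2 j
    apply hne
    obtain rfl := eq_of_geTup_of_sum_le h₁ (by omega)
    obtain rfl := eq_of_geTup_of_sum_le h₂ (by omega)
    rfl
  · obtain ⟨d, rfl⟩ := Nat.exists_eq_add_of_lt hlt
    have e₁ := geTup_sum_le (d := d + 1) h₁
    have e₂ := geTup_sum_le (d := d + 1) h₂
    have e₃ : n - s' = (n - (s' + d + 1)) + (d + 1) := by omega
    rw [e₃, add_mul _ (d + 1), mul_add (d + 1)]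
    change ∑ j : Fin (s' + d + 1), (a j : ℕ) + _ ≤ _ at e₁
    change ∑ j : Fin (s' + d + 1), (b j : ℕ) + _ ≤ _ at e₂
    omega

theorem PairIx.exists_step {x y : PairIx m q} (hx : x.s ≤ n) (h : y.ge x) (hne : x ≠ y) :
    ∃ z : PairIx m q, z.ge x ∧ y.ge z ∧ z.rank n = x.rank n + 1 := by
  obtain ⟨s, a, b, ha, hb⟩ := x
  obtain ⟨s', a', b', ha', hb'⟩ := y
  obtain ⟨h₁, h₂⟩ := h
  dsimp only at *
  rcases exists_raise_or_forall ha ha' h₁ with ⟨f, hf, hfa, haf, hsum⟩ | hra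
  · refine ⟨⟨s, f, b, hf, hb⟩, ⟨hfa, geTup_refl _⟩, ⟨haf, h₂⟩, ?_⟩
    rw [rank_mk, rank_mk]
    omega
  rcases exists_raise_or_forall hb hb' h₂ with ⟨f, hf, hfb, hbf, hsum⟩ | hrb
  · refine ⟨⟨s, a, f, ha, hf⟩, ⟨geTup_refl _, hfb⟩, ⟨h₁, hbf⟩, ?_⟩
    rw [rank_mk, rank_mk]
    omega
  rcases h₁.1.eq_or_lt with rfl | hlt
  · obtain rfl := eq_of_forall_eq_or_maximal ha' h₁ hra
    obtain rfl := eq_of_forall_eq_or_maximal hb' h₂ hrb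
    exact absurd rfl hne
  · obtain ⟨t, rfl⟩ : ∃ t, s = t + 1 := ⟨s - 1, by omega⟩
    refine ⟨⟨t, fun j => a j.castSucc, fun j => b j.castSucc, ha.comp Fin.strictMono_castSucc,
      hb.comp Fin.strictMono_castSucc⟩, ⟨geTup_castSucc_self a, geTup_castSucc_self b⟩,
      ⟨geTup_castSucc_of_le h₁ (Nat.le_of_lt_succ hlt),
        geTup_castSucc_of_le h₂ (Nat.le_of_lt_succ hlt)⟩, ?_⟩
    have ea : (a (Fin.last t) : ℕ) + 1 = m := by
      rcases hra (Fin.last t) with e | ⟨hj, _⟩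
      · rw [Fin.val_last] at e
        omega
      · rw [Fin.val_last] at hj
        omega
    have eb : (b (Fin.last t) : ℕ) + 1 = q := by
      rcases hrb (Fin.last t) with e | ⟨hj, _⟩
      · rw [Fin.val_last] at e
        omega
      · rw [Fin.val_last] at hj
        omega
    have e : n - t = n - (t + 1) + 1 := by omega
    rw [rank_mk, rank_mk, Fin.sum_univ_castSucc, Fin.sum_univ_castSucc, e, add_mul]
    omega

/-- The pair of tuples associated with an element of `H`: a tuple in `H_u` or `H_ξ` is completed
by the initial tuple `(1, …, n)`. -/
def toPair (hm : n ≤ m) (hq : n ≤ q) : HElt n m q → PairIx m q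
  | Sum.inl I => ⟨n, I.f, Fin.castLE hq, I.mono, Fin.strictMono_castLE hq⟩
  | Sum.inr (Sum.inl J) => ⟨n, Fin.castLE hm, J.f, Fin.strictMono_castLE hm, J.mono⟩
  | Sum.inr (Sum.inr P) => P.val

/-- The rank function of `H`, up to the additive constant `n ^ 2`. -/
def rank (hm : n ≤ m) (hq : n ≤ q) (x : HElt n m q) : ℕ :=
  (toPair hm hq x).rank n + match x with
    | Sum.inr (Sum.inr _) => 1
    | _ => 0

theorem rank_inl (hm : n ≤ m) (hq : n ≤ q) (I : IncTup n m) :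
    rank hm hq (Sum.inl I) = ∑ j, (I.f j : ℕ) + ∑ j : Fin n, (j : ℕ) + n := by
  change ∑ j, (I.f j : ℕ) + ∑ j : Fin n, (j : ℕ) + n + (n - n) * (m + q) = _
  rw [Nat.sub_self, zero_mul, add_zero]

theorem rank_inr_inl (hm : n ≤ m) (hq : n ≤ q) (J : IncTup n q) :
    rank hm hq (Sum.inr (Sum.inl J)) = ∑ j : Fin n, (j : ℕ) + ∑ j, (J.f j : ℕ) + n := by
  change ∑ j : Fin n, (j : ℕ) + ∑ j, (J.f j : ℕ) + n + (n - n) * (m + q) = _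
  rw [Nat.sub_self, zero_mul, add_zero]

theorem rank_inr_inr (hm : n ≤ m) (hq : n ≤ q) (P : {x : PairIx m q // 0 < x.s ∧ x.s ≤ n}) :
    rank hm hq (Sum.inr (Sum.inr P)) = P.val.rank n + 1 := rfl

theorem toPair_s_le (hm : n ≤ m) (hq : n ≤ q) (x : HElt n m q) : (toPair hm hq x).s ≤ n := by
  rcases x with I | J | P
  · exact le_rfl
  · exact le_rfl
  · exact P.2.2

theorem toPair_s_pos (hn : 0 < n) (hm : n ≤ m) (hq : n ≤ q) (x : HElt n m q) :
    0 < (toPair hm hq x).s := by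
  rcases x with I | J | P
  · exact hn
  · exact hn
  · exact P.2.1

theorem hle_pair_iff (hm : n ≤ m) (hq : n ≤ q) (x : HElt n m q)
    (P : {x : PairIx m q // 0 < x.s ∧ x.s ≤ n}) :
    hle x (Sum.inr (Sum.inr P)) ↔ P.val.ge (toPair hm hq x) := by
  rcases x with I | J | P'
  · exact ⟨fun h => ⟨h, geTup_castLE P.val.cmono P.2.2 hq⟩, fun h => h.1⟩
  · exact ⟨fun h => ⟨geTup_castLE P.val.rmono P.2.2 hm, h⟩, fun h => h.2⟩
  · exact Iff.rfl

theorem hle_refl (x : HElt n m q) : hle x x := by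
  rcases x with I | J | P
  · exact fun _ => le_rfl
  · exact fun _ => le_rfl
  · exact PairIx.ge_refl _

theorem toPair_ge (hm : n ≤ m) (hq : n ≤ q) {x y : HElt n m q} (h : hle x y) :
    (toPair hm hq y).ge (toPair hm hq x) := by
  rcases y with I | J | P
  · rcases x with I' | J' | P'
    · exact ⟨⟨le_rfl, h⟩, geTup_refl _⟩
    · exact h.elim
    · exact h.elim
  · rcases x with I' | J' | P'
    · exact h.elim
    · exact ⟨geTup_refl _, ⟨le_rfl, h⟩⟩
    · exact h.elim
  · exact (hle_pair_iff hm hq x P).mp h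

theorem hle_trans (hm : n ≤ m) (hq : n ≤ q) (x y z : HElt n m q) (hxy : hle x y)
    (hyz : hle y z) : hle x z := by
  rcases z with I | J | P
  · rcases y with I' | J' | P'
    · rcases x with I'' | J'' | P''
      · exact fun j => (hxy j).trans (hyz j)
      · exact hxy.elim
      · exact hxy.elim
    · exact hyz.elim
    · exact hyz.elim
  · rcases y with I' | J' | P'
    · exact hyz.elim
    · rcases x with I'' | J'' | P''
      · exact hxy.elim
      · exact fun j => (hxy j).trans (hyz j)
      · exact hxy.elim
    · exact hyz.elim
  · exact (hle_pair_iff hm hq x P).mpr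
      (PairIx.ge_trans ((hle_pair_iff hm hq y P).mp hyz) (toPair_ge hm hq hxy))

theorem PairIx.rank_le {x y : PairIx m q} (hx : x.s ≤ n) (h : y.ge x) :
    x.rank n ≤ y.rank n := by
  by_cases e : x = y
  · rw [e]
  · exact (PairIx.rank_lt hx h e).le

theorem rank_lt (hm : n ≤ m) (hq : n ≤ q) (x y : HElt n m q) (h : hle x y) (hne : x ≠ y) :
    rank hm hq x < rank hm hq y := by
  have hs := toPair_s_le hm hq x
  have hp := toPair_ge hm hq h
  have hle_rank := PairIx.rank_le hs hp
  have hlt_rank := PairIx.rank_lt hs hp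
  rcases y with ⟨I, hI⟩ | ⟨J, hJ⟩ | P
  · rcases x with ⟨I', hI'⟩ | J' | P'
    · refine hlt_rank fun e => hne ?_
      simp only [toPair, PairIx.mk.injEq, heq_eq_eq, true_and, and_true] at e
      subst e
      rfl
    · exact h.elim
    · exact h.elim
  · rcases x with I' | ⟨J', hJ'⟩ | P'
    · exact h.elim
    · refine hlt_rank fun e => hne ?_
      simp only [toPair, PairIx.mk.injEq, heq_eq_eq, true_and] at e
      subst e
      rfl
    · exact h.elim
  · rcases x with I' | J' | P'
    · exact Nat.lt_succ_of_le hle_rank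
    · exact Nat.lt_succ_of_le hle_rank
    · exact Nat.succ_lt_succ (hlt_rank fun e => hne (by rw [Subtype.ext e]))

/-- A strict inequality between tuples of the same length can be climbed one step at a time. -/
theorem exists_raise_of_ne {N s : ℕ} {f g : Fin s → Fin N} (hf : StrictMono f)
    (hg : StrictMono g) (h : ∀ j, f j ≤ g j) (hne : f ≠ g) :
    ∃ f' : Fin s → Fin N, StrictMono f' ∧ (∀ j, f j ≤ f' j) ∧ (∀ j, f' j ≤ g j) ∧
      ∑ j, (f' j : ℕ) = ∑ j, (f j : ℕ) + 1 := by
  have h' : geTup g f := ⟨le_rfl, h⟩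
  rcases exists_raise_or_forall hf hg h' with ⟨f', hf', h₁, h₂, hsum⟩ | hr
  · exact ⟨f', hf', h₁.2, h₂.2, hsum⟩
  · exact absurd (eq_of_forall_eq_or_maximal hg h' hr) hne

theorem exists_rank_succ (hn : 0 < n) (hm : n ≤ m) (hq : n ≤ q) (x y : HElt n m q)
    (h : hle x y) (hne : x ≠ y) :
    ∃ z, hle x z ∧ hle z y ∧ rank hm hq z = rank hm hq x + 1 := by
  rcases y with ⟨I, hI⟩ | ⟨J, hJ⟩ | P
  · rcases x with ⟨I', hI'⟩ | J' | P'
    · obtain ⟨f, hf, h₁, h₂, hsum⟩ := exists_raise_of_ne hI' hI h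
        (fun e => hne (by subst e; rfl))
      refine ⟨Sum.inl ⟨f, hf⟩, h₁, h₂, ?_⟩
      rw [rank_inl, rank_inl]
      dsimp only
      omega
    · exact h.elim
    · exact h.elim
  · rcases x with I' | ⟨J', hJ'⟩ | P'
    · exact h.elim
    · obtain ⟨f, hf, h₁, h₂, hsum⟩ := exists_raise_of_ne hJ' hJ h
        (fun e => hne (by subst e; rfl))
      refine ⟨Sum.inr (Sum.inl ⟨f, hf⟩), h₁, h₂, ?_⟩
      rw [rank_inr_inl, rank_inr_inl]
      dsimp only
      omega
    · exact h.elim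
  · have hp := (hle_pair_iff hm hq x P).mp h
    have hs := toPair_s_le hm hq x
    have hs' := toPair_s_pos hn hm hq x
    rcases x with I' | J' | P'
    · exact ⟨Sum.inr (Sum.inr ⟨toPair hm hq (Sum.inl I'), hs', hs⟩),
        (hle_pair_iff hm hq _ _).mpr (PairIx.ge_refl _), hp, rfl⟩
    · exact ⟨Sum.inr (Sum.inr ⟨toPair hm hq (Sum.inr (Sum.inl J')), hs', hs⟩),
        (hle_pair_iff hm hq _ _).mpr (PairIx.ge_refl _), hp, rfl⟩
    · obtain ⟨z, hzx, hyz, hz⟩ := PairIx.exists_step hs hp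
        (fun e => hne (by rw [← Subtype.ext e]))
      exact ⟨Sum.inr (Sum.inr ⟨z, P.2.1.trans_le hyz.1.1, hzx.1.1.trans hs⟩), hzx, hyz,
        congrArg (· + 1) hz⟩

theorem sum_add_sum_add_eq_sq (n : ℕ) :
    ∑ j : Fin n, (j : ℕ) + ∑ j : Fin n, (j : ℕ) + n = n ^ 2 := by
  rw [Fin.sum_univ_eq_sum_range (fun j => j) n, ← mul_two, Finset.sum_range_id_mul_two, sq]
  cases n with
  | zero => rfl
  | succ n => rw [Nat.add_sub_cancel]; ring

theorem exists_rank_eq_sq (hm : n ≤ m) (hq : n ≤ q) (y : HElt n m q) :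
    ∃ z, hle z y ∧ rank hm hq z = n ^ 2 := by
  have hu : rank hm hq (Sum.inl ⟨Fin.castLE hm, Fin.strictMono_castLE hm⟩) = n ^ 2 :=
    (rank_inl hm hq _).trans (sum_add_sum_add_eq_sq n)
  rcases y with I | J | P
  · exact ⟨Sum.inl ⟨_, _⟩, fun j => strictMono_index_le I.mono j, hu⟩
  · exact ⟨Sum.inr (Sum.inl ⟨Fin.castLE hq, Fin.strictMono_castLE hq⟩),
      fun j => strictMono_index_le J.mono j,
      (rank_inr_inl hm hq _).trans (sum_add_sum_add_eq_sq n)⟩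
  · exact ⟨Sum.inl ⟨_, _⟩, geTup_castLE P.val.rmono P.2.2 hm, hu⟩

theorem exists_greatest (hn : 0 < n) (hm : n ≤ m) (hq : n ≤ q) :
    ∃ t : HElt n m q, (∀ x, hle x t) ∧ rank hm hq t = (m + q) * n := by
  refine ⟨Sum.inr (Sum.inr ⟨⟨1, fun _ => ⟨m - 1, by omega⟩, fun _ => ⟨q - 1, by omega⟩,
    Subsingleton.strictMono _, Subsingleton.strictMono _⟩, Nat.one_pos, hn⟩), fun x => ?_, ?_⟩
  · rw [hle_pair_iff hm hq]
    have hs := toPair_s_pos hn hm hq x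
    exact ⟨⟨hs, fun j => Fin.le_def.mpr (Nat.le_sub_one_of_lt (Fin.isLt _))⟩,
      ⟨hs, fun j => Fin.le_def.mpr (Nat.le_sub_one_of_lt (Fin.isLt _))⟩⟩
  · obtain ⟨k, rfl⟩ : ∃ k, n = k + 1 := ⟨n - 1, by omega⟩
    rw [rank_inr_inr, PairIx.rank_mk, Fin.sum_univ_one, Fin.sum_univ_one, Nat.add_sub_cancel,
      mul_add (m + q), mul_one, mul_comm k]
    dsimp only
    omega

end SMB

open SMB in
/-- **`H` is a ranked poset of rank `(m+q)n − n²`.**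
Every maximal chain in the poset `H` has cardinality `(m+q)n − n² + 1`. -/
theorem H_is_ranked (n m q : ℕ) (hn : 0 < n) (hm : n < m) (hq : n < q)
    (C : Finset (HElt n m q)) (hC : IsChain hle (C : Set (HElt n m q)))
    (hmax : ∀ C' : Finset (HElt n m q),
      IsChain hle (C' : Set (HElt n m q)) → C ⊆ C' → C' = C) :
    C.card = (m + q) * n - n ^ 2 + 1 := by
  obtain ⟨t, ht, hrank⟩ := exists_greatest hn hm.le hq.le
  rw [← hrank]
  exact card_maximal_chain_of_rank hle hle_refl (hle_trans hm.le hq.le) (rank hm.le hq.le)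
    (rank_lt hm.le hq.le) (exists_rank_succ hn hm.le hq.le) (n ^ 2)
    (exists_rank_eq_sq hm.le hq.le) t ht C hC hmax
end
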